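/- Strengthened Whitney inequality for Hermite interpolation: Let r ∈ ℕ₀, m ≥ r+2, 0 < λ ≤ 1, and x_0 ≤ ... ≤ x_{m-1} with x_{j+r+1} - x_j ≥ λ(x_{m-1} - x_0) for all 0 ≤ j ≤ m-r-2. If f ∈ C^{(r)}(I), I = [x_0, x_{m-1}], then for all x ∈ I: |f(x) - L_{m-1}(x; f; x_0,...,x_{m-1})| ≤ C(m,λ) · |I|^r · ω_{m-r}(f^{(r)}, |I|; I), where L_{m-1} is the Hermite polynomial of degree ≤ m-1 interpolating f and its derivatives up to multiplicity at each knot. -/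

import Mathlib

open scoped BigOperators

open Classical in
/-- Divided difference with possibly repeated knots, via derivative data `F`
(`F j` is the `j`-th derivative). -/
noncomputable def divDiff (F : ℕ → ℝ → ℝ) : List ℝ → ℝ
  | [] => 0
  | [x] => F 0 x
  | x :: y :: l =>
      if h : ∀ z ∈ y :: l, z = x then
        F ((y :: l).length) x / Nat.factorial ((y :: l).length)
      else
        (divDiff F (y :: l) -
          divDiff F (x :: (y :: l).eraseIdx ((y :: l).findIdx (fun z => z ≠ x)))) /
          ((y :: l).getD ((y :: l).findIdx (fun z => z ≠ x)) 0 - x)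
termination_by l => l.length
decreasing_by
  · simp
  · push_neg at h
    obtain ⟨z, hz, hzx⟩ := h
    have hlt : (y :: l).findIdx (fun z => decide (z ≠ x)) < (y :: l).length :=
      List.findIdx_lt_length_of_exists ⟨z, hz, by simpa using hzx⟩
    simp only [List.length_cons, List.length_eraseIdx] at *
    rw [if_pos hlt]; omega

/-- Newton form of the Hermite interpolation polynomial at the knots `xs`. -/
noncomputable def newtonSum (F : ℕ → ℝ → ℝ) (xs : List ℝ) (t : ℝ) : ℝ :=
  ∑ j ∈ Finset.range xs.length,
    divDiff F (xs.take (j + 1)) * ∏ i ∈ Finset.range j, (t - xs.getD i 0)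

/-- The `k`-th symmetric difference of `g`, set to `0` when the relevant points
leave `[a,b]`. -/
noncomputable def kSymmDiff (k : ℕ) (g : ℝ → ℝ) (u x a b : ℝ) : ℝ :=
  if a ≤ x - (k / 2 : ℝ) * u ∧ x + (k / 2 : ℝ) * u ≤ b then
    ∑ i ∈ Finset.range (k + 1), (-1 : ℝ) ^ i * (k.choose i) * g (x + ((k : ℝ) / 2 - i) * u)
  else 0

/-- The `k`-th modulus of smoothness of `g` on `[a,b]`. -/
noncomputable def smoothOmega (k : ℕ) (g : ℝ → ℝ) (t a b : ℝ) : ℝ :=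
  sSup {v : ℝ | ∃ u x : ℝ, 0 < u ∧ u ≤ t ∧ v = |kSymmDiff k g u x a b|}

/-- First modulus of continuity of `g` on `[a,b]`. -/
noncomputable def omega1 (g : ℝ → ℝ) (t a b : ℝ) : ℝ :=
  sSup {v : ℝ | ∃ x y : ℝ, x ∈ Set.Icc a b ∧ y ∈ Set.Icc a b ∧ |x - y| ≤ t ∧ v = |g x - g y|}

/-- Sup norm on `[a,b]`. -/
noncomputable def supNorm (g : ℝ → ℝ) (a b : ℝ) : ℝ :=
  sSup {v : ℝ | ∃ x ∈ Set.Icc a b, v = |g x|}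

/-- The knots extended by `x₋₁ = x₀ - (xₘ - x₀)` and `x_{m+1} = xₘ + (xₘ - x₀)`. -/
noncomputable def xExt (m : ℕ) (x : ℕ → ℝ) : ℤ → ℝ := fun i =>
  if i < 0 then x 0 - (x m - x 0) else if (m : ℤ) < i then x m + (x m - x 0) else x i.toNat

/-- `d(p,q) = min (x_{q+1} - x_p) (x_q - x_{p-1})`. -/
noncomputable def dpq (m : ℕ) (x : ℕ → ℝ) (p q : ℕ) : ℝ :=
  min (xExt m x ((q : ℤ) + 1) - x p) (x q - xExt m x ((p : ℤ) - 1))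

/-- `Λ_{p,q,r}(x_0,…,x_m; φ)`. -/
noncomputable def Lam (m r : ℕ) (x : ℕ → ℝ) (φ : ℝ → ℝ) (p q : ℕ) : ℝ :=
  (∫ u in Set.Ioc (x q - x p) (dpq m x p q), u ^ ((p : ℤ) + r - q - 1) * φ u) /
    ((∏ i ∈ Finset.range p, (x q - x i)) * ∏ i ∈ Finset.Ioc q m, (x i - x p))

/-- `Λ_r(x_0,…,x_m; φ) = max over admissible (p,q) of Λ_{p,q,r}`. -/
noncomputable def LamMax (m r : ℕ) (x : ℕ → ℝ) (φ : ℝ → ℝ) : ℝ :=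
  sSup {v : ℝ | ∃ p q : ℕ, q ≤ m ∧ p + r + 1 ≤ q ∧ v = Lam m r x φ p q}

section Hermite

open Polynomial

/-- `H` is the Hermite interpolation polynomial of the derivative data `F` at the knots `S`. -/
def IsHermite (F : ℕ → ℝ → ℝ) (S : Multiset ℝ) (H : ℝ[X]) : Prop :=
  H.degree < (Multiset.card S : WithBot ℕ) ∧
    ∀ y, ∀ l < S.count y, (derivative^[l] H).eval y = F l y

theorem prod_X_sub_C_dvd_iff_iterate_derivative (S : Multiset ℝ) (D : ℝ[X]) :
    (S.map fun a => X - C a).prod ∣ D ↔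
      ∀ y, ∀ l < S.count y, (derivative^[l] D).eval y = 0 := by
  rcases eq_or_ne D 0 with rfl | hD
  · simp
  rw [Multiset.prod_X_sub_C_dvd_iff_le_roots hD, Multiset.le_iff_count]
  refine forall_congr' fun y => ?_
  rw [count_roots]
  constructor
  · intro h l hl
    exact isRoot_iterate_derivative_of_lt_rootMultiplicity (hl.trans_le h)
  · intro h
    rcases Nat.eq_zero_or_pos (S.count y) with h0 | h0
    · simp [h0]
    · have := lt_rootMultiplicity_of_isRoot_iterate_derivative (n := S.count y - 1) hD
        (fun m hm => h m (by omega))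
      omega

theorem IsHermite.prod_dvd_sub {F : ℕ → ℝ → ℝ} {S T : Multiset ℝ} {H H' : ℝ[X]}
    (h : IsHermite F S H) (h' : IsHermite F T H') {U : Multiset ℝ} (hS : U ≤ S) (hT : U ≤ T) :
    (U.map fun a => X - C a).prod ∣ H - H' := by
  rw [prod_X_sub_C_dvd_iff_iterate_derivative]
  intro y l hl
  rw [iterate_derivative_sub, eval_sub, h.2 y l (hl.trans_le (Multiset.count_le_of_le y hS)),
    h'.2 y l (hl.trans_le (Multiset.count_le_of_le y hT)), sub_self]

theorem degree_prod_X_sub_C (S : Multiset ℝ) :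
    (S.map fun a => X - C a).prod.degree = (Multiset.card S : WithBot ℕ) := by
  rw [degree_eq_natDegree (monic_multiset_prod_of_monic _ _ fun a _ => monic_X_sub_C a).ne_zero,
    natDegree_multiset_prod_X_sub_C_eq_card]

theorem IsHermite.unique {F : ℕ → ℝ → ℝ} {S : Multiset ℝ} {H H' : ℝ[X]}
    (h : IsHermite F S H) (h' : IsHermite F S H') : H = H' := by
  have hd := h.prod_dvd_sub h' le_rfl le_rfl
  refine sub_eq_zero.1 (eq_zero_of_dvd_of_degree_lt hd ?_)
  rw [degree_prod_X_sub_C]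
  exact (degree_sub_le _ _).trans_lt (max_lt h.1 h'.1)

theorem eval_iterate_derivative_eq_of_prod_dvd_sub {S : Multiset ℝ} {H H' : ℝ[X]}
    (h : (S.map fun a => X - C a).prod ∣ H - H') {y : ℝ} {l : ℕ} (hl : l < S.count y) :
    (derivative^[l] H).eval y = (derivative^[l] H').eval y := by
  have := (prod_X_sub_C_dvd_iff_iterate_derivative S _).1 h y l hl
  rwa [iterate_derivative_sub, eval_sub, sub_eq_zero] at this

/-- The Aitken–Neville recursion for Hermite interpolation. -/
theorem IsHermite.aitken {F : ℕ → ℝ → ℝ} {T : Multiset ℝ} {x z : ℝ} {H₁ H₂ : ℝ[X]} (hxz : z ≠ x)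
    (h₁ : IsHermite F (z ::ₘ T) H₁) (h₂ : IsHermite F (x ::ₘ T) H₂) :
    IsHermite F (x ::ₘ z ::ₘ T)
      (C (z - x)⁻¹ * ((X - C x) * H₁ - (X - C z) * H₂)) := by
  have hzx : z - x ≠ 0 := sub_ne_zero.2 hxz
  have hC : (C (z - x)⁻¹ : ℝ[X]) * (C z - C x) = 1 := by
    rw [← C_sub, ← C_mul, inv_mul_cancel₀ hzx, C_1]
  obtain ⟨q, hq⟩ := h₁.prod_dvd_sub h₂ (U := T) (Multiset.le_cons_self _ _)
    (Multiset.le_cons_self _ _)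
  set H := C (z - x)⁻¹ * ((X - C x) * H₁ - (X - C z) * H₂) with hH
  have e₁ : H - H₁ = C (z - x)⁻¹ * ((X - C z) * (H₁ - H₂)) := by
    linear_combination hH + H₁ * hC
  have e₂ : H - H₂ = C (z - x)⁻¹ * ((X - C x) * (H₁ - H₂)) := by
    linear_combination hH + H₂ * hC
  have d₁ : ((z ::ₘ T).map fun a => X - C a).prod ∣ H - H₁ := by
    rw [e₁, hq, Multiset.map_cons, Multiset.prod_cons]
    exact Dvd.intro (C (z - x)⁻¹ * q) (by ring)
  have d₂ : ((x ::ₘ T).map fun a => X - C a).prod ∣ H - H₂ := by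
    rw [e₂, hq, Multiset.map_cons, Multiset.prod_cons]
    exact Dvd.intro (C (z - x)⁻¹ * q) (by ring)
  refine ⟨?_, fun y l hl => ?_⟩
  · have h₁' := (degree_lt_iff_coeff_zero _ _).1 h₁.1
    have h₂' := (degree_lt_iff_coeff_zero _ _).1 h₂.1
    refine (degree_lt_iff_coeff_zero _ _).2 fun n hn => ?_
    simp only [Multiset.card_cons] at h₁' h₂' hn
    obtain ⟨n, rfl⟩ : ∃ k, n = k + 1 := ⟨n - 1, by omega⟩
    rw [hH, coeff_C_mul, coeff_sub, sub_mul, sub_mul, coeff_sub, coeff_sub, coeff_X_mul,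
      coeff_X_mul, coeff_C_mul, coeff_C_mul, h₁' n (by omega), h₁' (n + 1) (by omega),
      h₂' n (by omega), h₂' (n + 1) (by omega)]
    simp
  · rcases eq_or_ne y x with rfl | hyx
    · have hl' : l < (y ::ₘ T).count y := by
        rw [Multiset.cons_swap, Multiset.count_cons_of_ne hxz.symm] at hl
        exact hl
      rw [eval_iterate_derivative_eq_of_prod_dvd_sub d₂ hl', h₂.2 y l hl']
    · have hl' : l < (z ::ₘ T).count y := by
        rwa [Multiset.count_cons_of_ne hyx] at hl
      rw [eval_iterate_derivative_eq_of_prod_dvd_sub d₁ hl', h₁.2 y l hl']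

theorem coeff_aitken {F : ℕ → ℝ → ℝ} {T : Multiset ℝ} {x z : ℝ} {H₁ H₂ : ℝ[X]}
    (h₁ : IsHermite F (z ::ₘ T) H₁) (h₂ : IsHermite F (x ::ₘ T) H₂) :
    (C (z - x)⁻¹ * ((X - C x) * H₁ - (X - C z) * H₂)).coeff (Multiset.card T + 1) =
      (H₁.coeff (Multiset.card T) - H₂.coeff (Multiset.card T)) / (z - x) := by
  have h₁' := (degree_lt_iff_coeff_zero _ _).1 h₁.1 (Multiset.card T + 1) (by simp)
  have h₂' := (degree_lt_iff_coeff_zero _ _).1 h₂.1 (Multiset.card T + 1) (by simp)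
  rw [coeff_C_mul, coeff_sub, sub_mul, sub_mul, coeff_sub, coeff_sub, coeff_X_mul,
      coeff_X_mul, coeff_C_mul, coeff_C_mul, h₁', h₂']
  ring

/-- At a single repeated knot the Hermite polynomial is the Taylor polynomial. -/
theorem isHermite_replicate (F : ℕ → ℝ → ℝ) (x : ℝ) (n : ℕ) :
    ∃ H : ℝ[X], IsHermite F (Multiset.replicate (n + 1) x) H ∧
      H.coeff n = F n x / n.factorial := by
  set G : ℝ[X] := ∑ i ∈ Finset.range (n + 1), monomial i (F i x / i.factorial) with hG
  have hcoeff : ∀ j, G.coeff j = if j < n + 1 then F j x / j.factorial else 0 := by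
    intro j
    simp [hG, finsetSum_coeff, coeff_monomial]
  have hdeg : G.degree < ((n + 1 : ℕ) : WithBot ℕ) :=
    (degree_lt_iff_coeff_zero _ _).2 fun m hm => by rw [hcoeff, if_neg (by omega)]
  refine ⟨taylor (-x) G, ⟨?_, fun y l hl => ?_⟩, ?_⟩
  · simpa [degree_taylor] using hdeg
  · rw [Multiset.count_replicate] at hl
    split_ifs at hl with hy
    · subst hy
      have h1 : taylor x (taylor (-x) G) = G := by
        rw [taylor_taylor]; simp
      have h2 := taylor_coeff (r := x) (f := taylor (-x) G) l
      rw [h1, hcoeff, if_pos hl] at h2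
      rw [← factorial_smul_hasseDeriv]
      rw [LinearMap.smul_apply, eval_smul, ← h2, nsmul_eq_mul]
      have := Nat.factorial_ne_zero l
      field_simp
    · omega
  · have h3 : (taylor (-x) G).coeff n = G.coeff n := by
      rw [taylor_coeff]
      have : hasseDeriv n G = C (G.coeff n) := by
        ext j
        rw [hasseDeriv_coeff, coeff_C]
        split_ifs with hj
        · simp [hj]
        · rw [hcoeff, if_neg (by omega)]; simp
      rw [this, eval_C]
    rw [h3, hcoeff, if_pos (by omega)]

theorem exists_isHermite_divDiff (F : ℕ → ℝ → ℝ) : ∀ (n : ℕ) (xs : List ℝ), xs.length = n + 1 →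
    ∃ H : ℝ[X], IsHermite F (xs : Multiset ℝ) H ∧ H.coeff n = divDiff F xs := by
  intro n
  induction n with
  | zero =>
    intro xs hxs
    obtain ⟨x, rfl⟩ := List.length_eq_one_iff.1 hxs
    obtain ⟨H, h1, h2⟩ := isHermite_replicate F x 0
    exact ⟨H, by simpa using h1, by simpa [divDiff] using h2⟩
  | succ n ih =>
    intro xs hxs
    match xs, hxs with
    | x :: y :: l, hxs =>
    by_cases h : ∀ w ∈ y :: l, w = x
    · have hrep : (x :: y :: l) = List.replicate (n + 1 + 1) x :=
        List.eq_replicate_iff.2 ⟨hxs, by simpa using h⟩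
      obtain ⟨H, h1, h2⟩ := isHermite_replicate F x (n + 1)
      have hlen : (y :: l).length = n + 1 := by simpa using hxs
      refine ⟨H, by rw [hrep]; exact h1, ?_⟩
      rw [divDiff, dif_pos h, hlen, h2]
    · rw [divDiff, dif_neg h]
      set k := (y :: l).findIdx (fun w => decide (w ≠ x)) with hk
      have hklt : k < (y :: l).length := by
        push Not at h
        obtain ⟨w, hw, hwx⟩ := h
        exact List.findIdx_lt_length_of_exists ⟨w, hw, by simpa using hwx⟩
      have hzx : (y :: l)[k] ≠ x := by
        have := List.findIdx_getElem (w := hklt)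
        simpa [hk] using this
      have hperm : (((y :: l) : List ℝ) : Multiset ℝ) =
          (y :: l)[k] ::ₘ (((y :: l).eraseIdx k : List ℝ) : Multiset ℝ) := by
        rw [Multiset.cons_coe, Multiset.coe_eq_coe]
        exact (List.getElem_cons_eraseIdx_perm hklt).symm
      have hlen : (y :: l).length = n + 1 := by simpa using hxs
      have hlenE : ((y :: l).eraseIdx k).length = n := by
        rw [List.length_eraseIdx_of_lt hklt, hlen]; rfl
      obtain ⟨H₁, h1, c1⟩ := ih (y :: l) hlen
      obtain ⟨H₂, h2, c2⟩ := ih (x :: (y :: l).eraseIdx k) (by simp [hlenE])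
      have hgetD : (y :: l).getD k 0 = (y :: l)[k] := by
        rw [List.getD_eq_getElem _ _ hklt]
      rw [hperm] at h1
      rw [← Multiset.cons_coe] at h2
      have hA := h1.aitken hzx h2
      have hc := coeff_aitken h1 h2
      rw [Multiset.coe_card, hlenE, c1, c2] at hc
      rw [← Multiset.cons_coe, hperm, hgetD]
      exact ⟨_, hA, hc⟩

theorem prod_map_take_eq (g : ℝ → ℝ) (xs : List ℝ) (n : ℕ) (hn : n ≤ xs.length) :
    ((xs.take n).map g).prod = ∏ i ∈ Finset.range n, g (xs.getD i 0) := by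
  induction n with
  | zero => simp
  | succ n ih =>
    rw [Finset.prod_range_succ, ← ih (by omega), List.take_succ_eq_append_getElem (by omega),
      List.map_append, List.prod_append, List.getD_eq_getElem _ _ (by omega)]
    simp

/-- The Newton form evaluates the Hermite interpolation polynomial. -/
theorem IsHermite.sum_divDiff_eq {F : ℕ → ℝ → ℝ} (xs : List ℝ) (t : ℝ) (n : ℕ)
    (hn : n ≤ xs.length) : ∀ {H : ℝ[X]}, IsHermite F (xs.take n : List ℝ) H →
    ∑ j ∈ Finset.range n,
      divDiff F (xs.take (j + 1)) * ∏ i ∈ Finset.range j, (t - xs.getD i 0) = H.eval t := by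
  induction n with
  | zero =>
    intro H hH
    have : H = 0 := by
      have := hH.1
      simpa [degree_lt_iff_coeff_zero, Polynomial.ext_iff] using this
    simp [this]
  | succ n ih =>
    intro H hH
    obtain ⟨H', hH', hc⟩ := exists_isHermite_divDiff F n (xs.take (n + 1))
      (by rw [List.length_take]; omega)
    obtain rfl := hH'.unique hH
    have hlen : (xs.take n).length = n := by rw [List.length_take]; omega
    set Pn : ℝ[X] := (((xs.take n : List ℝ) : Multiset ℝ).map fun a => X - C a).prod with hPn
    have hmonic : Pn.Monic := monic_multiset_prod_of_monic _ _ fun a _ => monic_X_sub_C a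
    have hPdeg : Pn.natDegree = n := by
      rw [hPn, natDegree_multiset_prod_X_sub_C_eq_card, Multiset.coe_card, hlen]
    have hPeval : Pn.eval t = ∏ i ∈ Finset.range n, (t - xs.getD i 0) := by
      rw [← prod_map_take_eq (fun a => t - a) xs n (by omega), hPn, eval_multiset_prod]
      simp [Function.comp_def]
    have key : IsHermite F (xs.take n : List ℝ) (H' - C (H'.coeff n) * Pn) := by
      refine ⟨?_, fun y l hl => ?_⟩
      · rw [Multiset.coe_card, hlen]
        refine (degree_lt_iff_coeff_zero _ _).2 fun m hm => ?_
        rw [coeff_sub, coeff_C_mul]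
        rcases hm.eq_or_lt with rfl | hm
        · have : Pn.coeff n = 1 := by rw [← hPdeg]; exact hmonic
          rw [this]; ring
        · rw [coeff_eq_zero_of_natDegree_lt (p := Pn) (by omega),
            (degree_lt_iff_coeff_zero _ _).1 hH'.1 m
              (by rw [Multiset.coe_card, List.length_take]; omega)]
          ring
      · rw [eval_iterate_derivative_eq_of_prod_dvd_sub (H' := H') _ hl]
        · refine hH'.2 y l (hl.trans_le ?_)
          exact Multiset.count_le_of_le _ (Multiset.coe_le.2
            ((List.take_sublist_take_left (by omega)).subperm))
        · exact Dvd.intro (-C (H'.coeff n)) (by ring)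
    rw [Finset.sum_range_succ, ih (by omega) key, ← hc, ← hPeval]
    simp

theorem newtonSum_eq_eval {F : ℕ → ℝ → ℝ} {xs : List ℝ} {H : ℝ[X]}
    (hH : IsHermite F (xs : Multiset ℝ) H) (t : ℝ) : newtonSum F xs t = H.eval t :=
  IsHermite.sum_divDiff_eq xs t xs.length le_rfl (by rwa [List.take_length])

end Hermite

section Whitney

open Polynomial intervalIntegral

/-- The `k`-th forward difference of `g` at `y` with step `u`, up to sign. -/
def altDiff (k : ℕ) (g : ℝ → ℝ) (y u : ℝ) : ℝ :=
  ∑ i ∈ Finset.range (k + 1), (-1 : ℝ) ^ i * (k.choose i) * g (y + i * u)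

theorem altDiff_sub (k : ℕ) (g p : ℝ → ℝ) (y u : ℝ) :
    altDiff k (fun x => g x - p x) y u = altDiff k g y u - altDiff k p y u := by
  simp only [altDiff, ← Finset.sum_sub_distrib]
  exact Finset.sum_congr rfl fun i _ => by ring

theorem altDiff_eval_eq_zero {k : ℕ} {P : ℝ[X]} (hk : 0 < k) (hP : P.degree < (k : WithBot ℕ))
    (y u : ℝ) : altDiff k (fun x => P.eval x) y u = 0 := by
  set Q : ℝ[X] := P.comp (C y + C u * X) with hQ
  have hQd : Q.natDegree < k := by
    have h1 : P.natDegree < k := by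
      rcases eq_or_ne P 0 with rfl | h0
      · simpa using hk
      · exact (natDegree_lt_iff_degree_lt h0).2 hP
    have h2 : (C y + C u * X : ℝ[X]).natDegree ≤ 1 := by compute_degree
    calc Q.natDegree ≤ P.natDegree * (C y + C u * X : ℝ[X]).natDegree := natDegree_comp_le
      _ ≤ P.natDegree * 1 := Nat.mul_le_mul_left _ h2
      _ < k := by omega
  have h := congrFun (Polynomial.fwdDiff_iter_eq_zero_of_degree_lt hQd) 0
  rw [fwdDiff_iter_eq_sum_shift] at h
  have h' : altDiff k (fun x => P.eval x) y u = (-1) ^ k * 0 := by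
    rw [← Pi.zero_apply (M := fun _ : ℝ => ℝ) (0 : ℝ), ← h, Finset.mul_sum]
    refine Finset.sum_congr rfl fun i hi => ?_
    have hi' : i ≤ k := by simpa [Nat.lt_succ_iff] using hi
    have hsign : (-1 : ℝ) ^ k * (-1) ^ (k - i) = (-1) ^ i := by
      rw [← pow_add, show k + (k - i) = 2 * (k - i) + i by omega, pow_add, pow_mul]; simp
    simp only [hQ, eval_comp, eval_add, eval_C, eval_mul, eval_X, zsmul_eq_mul, nsmul_eq_mul]
    push_cast
    rw [← hsign]
    ring_nf
  simpa using h'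

theorem sum_range_choose_real (k : ℕ) :
    ∑ i ∈ Finset.range (k + 1), (k.choose i : ℝ) = 2 ^ k := by
  exact_mod_cast Nat.sum_range_choose k

/-- A function whose `k`-th differences are small and which vanishes at the first `k` grid points
is small on the whole grid. -/
theorem abs_le_on_grid {k N : ℕ} (hk : 0 < k) {e : ℝ → ℝ} {W : ℝ} (hW : 0 ≤ W)
    (hD : ∀ y u, y ∈ Set.Icc (0 : ℝ) 1 → y + k * u ∈ Set.Icc (0 : ℝ) 1 → |altDiff k e y u| ≤ W)
    (h0 : ∀ i : ℕ, i < k → e (i / N) = 0) (i : ℕ) (hi : i ≤ N) :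
    |e (i / N)| ≤ (1 + 2 ^ k) ^ i * W := by
  induction i using Nat.strong_induction_on with
  | _ i ih =>
    rcases lt_or_ge i k with h | h
    · rw [h0 i h, abs_zero]; positivity
    have hN : (0 : ℝ) < N := by exact_mod_cast (by omega : 0 < N)
    obtain ⟨j, rfl⟩ := Nat.exists_eq_add_of_le' h
    have hd := hD (j / N) (1 / N)
      ⟨by positivity, by rw [div_le_one hN]; exact_mod_cast (by omega : j ≤ N)⟩
      ⟨by positivity, by
        rw [mul_one_div, ← add_div, div_le_one hN]; exact_mod_cast hi⟩
    rw [altDiff, Finset.sum_range_succ] at hd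
    have hpt : ∀ l : ℕ, (j / N + l * (1 / N) : ℝ) = ((j + l : ℕ) : ℝ) / N := by
      intro l; push_cast; ring
    simp only [hpt, Nat.choose_self, Nat.cast_one, mul_one] at hd
    set s := ∑ l ∈ Finset.range k, (-1 : ℝ) ^ l * (k.choose l) * e (((j + l : ℕ) : ℝ) / N) with hs
    have hq : ∀ l < k, |e (((j + l : ℕ) : ℝ) / N)| ≤ (1 + 2 ^ k) ^ (j + k - 1) * W := fun l hl =>
      (ih (j + l) (by omega) (by omega)).trans <| mul_le_mul_of_nonneg_right
        (pow_le_pow_right₀ (by linarith [show (0 : ℝ) < 2 ^ k by positivity]) (by omega)) hW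
    have hs' : |s| ≤ 2 ^ k * ((1 + 2 ^ k) ^ (j + k - 1) * W) := by
      have hq0 : 0 ≤ (1 + 2 ^ k) ^ (j + k - 1) * W := by positivity
      generalize (1 + 2 ^ k) ^ (j + k - 1) * W = q at hq hq0 ⊢
      rw [← sum_range_choose_real, Finset.sum_mul, Finset.sum_range_succ]
      refine (Finset.abs_sum_le_sum_abs _ _).trans ?_
      refine le_add_of_le_of_nonneg (Finset.sum_le_sum fun l hl => ?_) (by positivity)
      rw [abs_mul, abs_mul, abs_pow, abs_neg, abs_one, one_pow, one_mul, Nat.abs_cast]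
      exact mul_le_mul_of_nonneg_left (hq l (Finset.mem_range.1 hl)) (by positivity)
    have h1 : |e (((j + k : ℕ) : ℝ) / N)| = |(-1 : ℝ) ^ k * e (((j + k : ℕ) : ℝ) / N)| := by
      rw [abs_mul, abs_pow, abs_neg, abs_one, one_pow, one_mul]
    have h2 : |(-1 : ℝ) ^ k * e (((j + k : ℕ) : ℝ) / N)| ≤ W + |s| := by
      have := abs_sub_abs_le_abs_sub ((-1 : ℝ) ^ k * e (((j + k : ℕ) : ℝ) / N)) (-s)
      rw [abs_neg, sub_neg_eq_add, add_comm _ s] at this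
      linarith
    rw [h1]
    have h3 : (1 : ℝ) ≤ (1 + 2 ^ k) ^ (j + k - 1) :=
      one_le_pow₀ (by linarith [show (0 : ℝ) < 2 ^ k by positivity])
    have h4 : (1 + 2 ^ k : ℝ) ^ (j + k) = (1 + 2 ^ k) ^ (j + k - 1) * (1 + 2 ^ k) := by
      rw [← pow_succ]; congr 1; omega
    rw [h4]
    nlinarith [mul_le_mul_of_nonneg_right h3 hW]

theorem abs_integral_shift_sub_le {e : ℝ → ℝ} (he : Continuous e) {M : ℝ}
    (hM : ∀ x ∈ Set.Icc (0 : ℝ) 1, |e x| ≤ M) {x y L : ℝ} (hL : 0 ≤ L) (hx : 0 ≤ x) (hy : 0 ≤ y)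
    (hxL : x + L ≤ 1) (hyL : y + L ≤ 1) :
    |(∫ s in x..(x + L), e s) - ∫ s in y..(y + L), e s| ≤ 2 * M * |x - y| := by
  have hi : ∀ a b, IntervalIntegrable e MeasureTheory.volume a b := fun a b =>
    he.intervalIntegrable a b
  have h1 : (∫ s in x..(x + L), e s) - ∫ s in y..(y + L), e s =
      (∫ s in x..y, e s) - ∫ s in (x + L)..(y + L), e s := by
    have a := integral_add_adjacent_intervals (hi x y) (hi y (y + L))
    have b := integral_add_adjacent_intervals (hi x (x + L)) (hi (x + L) (y + L))
    linarith
  have bd : ∀ a b, a ∈ Set.Icc (0 : ℝ) 1 → b ∈ Set.Icc (0 : ℝ) 1 →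
      |∫ s in a..b, e s| ≤ M * |b - a| := by
    intro a b ha hb
    rw [← Real.norm_eq_abs]
    refine norm_integral_le_of_norm_le_const fun s hs => hM s ?_
    exact (Set.uIcc_subset_Icc ha hb) (Set.uIoc_subset_uIcc hs)
  rw [h1]
  refine (abs_sub _ _).trans ?_
  have b1 := bd x y ⟨hx, by linarith⟩ ⟨hy, by linarith⟩
  have b2 := bd (x + L) (y + L) ⟨by linarith, hxL⟩ ⟨by linarith, hyL⟩
  rw [show y + L - (x + L) = y - x by ring] at b2
  rw [abs_sub_comm y x] at b1 b2
  linarith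

/-- Averaging the `k`-th difference over the step shows that a function with small `k`-th
differences is nearly Lipschitz. -/
theorem abs_sub_le_of_altDiff {k : ℕ} (hk : 0 < k) {e : ℝ → ℝ} (he : Continuous e) {W M : ℝ}
    (hD : ∀ y u, y ∈ Set.Icc (0 : ℝ) 1 → y + k * u ∈ Set.Icc (0 : ℝ) 1 → |altDiff k e y u| ≤ W)
    (hM : ∀ x ∈ Set.Icc (0 : ℝ) 1, |e x| ≤ M) {x y : ℝ} (hx : x ∈ Set.Icc (0 : ℝ) (1 / 2))
    (hy : y ∈ Set.Icc (0 : ℝ) (1 / 2)) :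
    |e x - e y| ≤ 2 * W + 2 ^ (k + 2) * k * M * |x - y| := by
  have hM0 : 0 ≤ M := (abs_nonneg _).trans (hM 0 (by simp))
  have hk' : (0 : ℝ) < k := by exact_mod_cast hk
  set h : ℝ := 1 / (2 * k) with hh
  have hh0 : 0 < h := by positivity
  have hkh : k * h = 1 / 2 := by rw [hh]; field_simp
  have cont : ∀ (z : ℝ) (i : ℕ),
      Continuous fun u : ℝ => (-1 : ℝ) ^ i * (k.choose i) * e (z + i * u) := fun z i => by fun_prop
  have expand : ∀ z : ℝ, (∫ u in (0 : ℝ)..h, altDiff k e z u) =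
      (∑ i ∈ Finset.range k, (-1 : ℝ) ^ (i + 1) * (k.choose (i + 1)) *
        (((i + 1 : ℕ) : ℝ)⁻¹ * ∫ s in z..(z + (i + 1 : ℕ) * h), e s)) + h * e z := by
    intro z
    simp only [altDiff]
    rw [integral_finsetSum fun i _ => (cont z i).intervalIntegrable _ _, Finset.sum_range_succ']
    congr 1
    · refine Finset.sum_congr rfl fun i _ => ?_
      rw [integral_const_mul]
      congr 1
      have := integral_comp_add_mul (a := 0) (b := h) e
        (c := ((i + 1 : ℕ) : ℝ)) (by positivity) z
      simpa using this
    · simp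
  have bound : ∀ z ∈ Set.Icc (0 : ℝ) (1 / 2), |∫ u in (0 : ℝ)..h, altDiff k e z u| ≤ W * h := by
    intro z hz
    have := norm_integral_le_of_norm_le_const (a := 0) (b := h) (C := W)
      (f := fun u => altDiff k e z u) fun u hu => by
        rw [Set.uIoc_of_le hh0.le] at hu
        have : k * u ≤ k * h := mul_le_mul_of_nonneg_left hu.2 hk'.le
        have : 0 ≤ k * u := mul_nonneg hk'.le hu.1.le
        exact hD z u ⟨hz.1, by linarith [hz.2]⟩ ⟨by linarith [hz.1], by linarith [hz.2]⟩
    rwa [sub_zero, abs_of_pos hh0, Real.norm_eq_abs] at this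
  set A : ℝ → ℝ := fun z => ∑ i ∈ Finset.range k, (-1 : ℝ) ^ (i + 1) * (k.choose (i + 1)) *
        (((i + 1 : ℕ) : ℝ)⁻¹ * ∫ s in z..(z + (i + 1 : ℕ) * h), e s) with hA
  have hAd : |A x - A y| ≤ 2 ^ k * (2 * M * |x - y|) := by
    rw [hA]
    simp only
    rw [← Finset.sum_sub_distrib, ← sum_range_choose_real, Finset.sum_mul, Finset.sum_range_succ']
    refine (Finset.abs_sum_le_sum_abs _ _).trans ?_
    refine le_add_of_le_of_nonneg (Finset.sum_le_sum fun i hi => ?_) (by positivity)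
    have hi' : i < k := Finset.mem_range.1 hi
    have hL : ((i + 1 : ℕ) : ℝ) * h ≤ 1 / 2 := by
      rw [← hkh]
      exact mul_le_mul_of_nonneg_right (by exact_mod_cast hi') hh0.le
    rw [← mul_sub, ← mul_sub, abs_mul, abs_mul, abs_mul, abs_pow, abs_neg, abs_one, one_pow,
      one_mul, Nat.abs_cast]
    refine mul_le_mul_of_nonneg_left ?_ (by positivity)
    have hint := abs_integral_shift_sub_le he hM (x := x) (y := y) (L := ((i + 1 : ℕ) : ℝ) * h)
      (by positivity) hx.1 hy.1 (by linarith [hx.2]) (by linarith [hy.2])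
    have hinv : |((i + 1 : ℕ) : ℝ)⁻¹| ≤ 1 := by
      rw [abs_inv, Nat.abs_cast]
      exact inv_le_one_of_one_le₀ (by exact_mod_cast (by omega : 1 ≤ i + 1))
    calc _ ≤ 1 * |_| := mul_le_mul_of_nonneg_right hinv (abs_nonneg _)
      _ ≤ _ := by rw [one_mul]; exact hint
  have ex := expand x
  have ey := expand y
  have bx := abs_le.1 (bound x hx)
  have bY := abs_le.1 (bound y hy)
  have hAd' := abs_le.1 hAd
  have main : |h * (e x - e y)| ≤ 2 * W * h + 2 ^ k * (2 * M * |x - y|) := by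
    rw [abs_le]
    change _ = A x + _ at ex
    change _ = A y + _ at ey
    constructor <;> linarith
  rw [abs_mul, abs_of_pos hh0] at main
  have h2 : h * (2 * k) = 1 := by linarith
  calc |e x - e y| = (h * |e x - e y|) * (2 * k) := by linear_combination (-|e x - e y|) * h2
    _ ≤ (2 * W * h + 2 ^ k * (2 * M * |x - y|)) * (2 * k) :=
        mul_le_mul_of_nonneg_right main (by positivity)
    _ = _ := by rw [pow_add]; linear_combination (2 * W) * h2

theorem exists_whitney_unit {k : ℕ} (hk : 0 < k) : ∃ C : ℝ, 0 < C ∧ ∀ g : ℝ → ℝ, Continuous g →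
    ∀ W : ℝ, 0 ≤ W →
    (∀ y u, y ∈ Set.Icc (0 : ℝ) 1 → y + k * u ∈ Set.Icc (0 : ℝ) 1 → |altDiff k g y u| ≤ W) →
    ∃ P : ℝ[X], P.degree < (k : WithBot ℕ) ∧ ∀ x ∈ Set.Icc (0 : ℝ) 1, |g x - P.eval x| ≤ C * W := by
  set n : ℕ := 2 ^ (k + 2) * k with hn
  have hnpos : 0 < n := by positivity
  set N : ℕ := 2 * n with hN
  have hNpos : (0 : ℝ) < N := by exact_mod_cast (by omega : 0 < N)
  have hkN : k ≤ N := by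
    have : 1 ≤ 2 ^ (k + 2) := Nat.one_le_two_pow
    nlinarith
  set K : ℝ := (1 + 2 ^ k) ^ N with hK
  have hKpos : 0 < K := by positivity
  refine ⟨2 * (K + 2), by positivity, fun g hg W hW hD => ?_⟩
  have hinj : Set.InjOn (fun i : ℕ => (i : ℝ) / N) (Finset.range k) := by
    intro a _ b _ hab
    have : (a : ℝ) = b := by
      have := hab
      simp only at this
      field_simp at this
      exact this
    exact_mod_cast this
  set P : ℝ[X] := Lagrange.interpolate (Finset.range k) (fun i : ℕ => (i : ℝ) / N)
    (fun i : ℕ => g (i / N)) with hP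
  have hPdeg : P.degree < (k : WithBot ℕ) := by
    have := Lagrange.degree_interpolate_lt (s := Finset.range k) (fun i : ℕ => g (i / N)) hinj
    rwa [Finset.card_range] at this
  refine ⟨P, hPdeg, ?_⟩
  set e : ℝ → ℝ := fun x => g x - P.eval x with he
  have hec : Continuous e := hg.sub P.continuous
  have heD : ∀ y u, y ∈ Set.Icc (0 : ℝ) 1 → y + k * u ∈ Set.Icc (0 : ℝ) 1 →
      |altDiff k e y u| ≤ W := by
    intro y u hy hu
    rw [he, altDiff_sub, altDiff_eval_eq_zero hk hPdeg, sub_zero]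
    exact hD y u hy hu
  have he0 : ∀ i : ℕ, i < k → e (i / N) = 0 := by
    intro i hi
    have := Lagrange.eval_interpolate_at_node (fun i : ℕ => g (i / N)) hinj (Finset.mem_range.2 hi)
    simp only [he, hP, this, sub_self]
  have hgrid : ∀ i : ℕ, i ≤ N → |e (i / N)| ≤ K * W := fun i hi =>
    (abs_le_on_grid hk hW heD he0 i hi).trans (mul_le_mul_of_nonneg_right
      (pow_le_pow_right₀ (by linarith [show (0 : ℝ) < 2 ^ k by positivity]) hi) hW)
  obtain ⟨x₀, hx₀, hmax⟩ := isCompact_Icc.exists_isMaxOn (Set.nonempty_Icc.2 zero_le_one)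
    (hec.abs.continuousOn (s := Set.Icc (0 : ℝ) 1))
  set M := |e x₀| with hM
  have hMb : ∀ x ∈ Set.Icc (0 : ℝ) 1, |e x| ≤ M := fun x hx => hmax hx
  have half : ∀ e' : ℝ → ℝ, Continuous e' →
      (∀ y u, y ∈ Set.Icc (0 : ℝ) 1 → y + k * u ∈ Set.Icc (0 : ℝ) 1 → |altDiff k e' y u| ≤ W) →
      (∀ x ∈ Set.Icc (0 : ℝ) 1, |e' x| ≤ M) → (∀ i : ℕ, i ≤ N → |e' (i / N)| ≤ K * W) →
      ∀ x ∈ Set.Icc (0 : ℝ) (1 / 2), |e' x| ≤ (K + 2) * W + M / 2 := by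
    intro e' hec' hD' hM' hg' x hx
    set i := ⌊x * N⌋₊ with hi
    have hxN : 0 ≤ x * N := mul_nonneg hx.1 hNpos.le
    have hi1 : (i : ℝ) ≤ x * N := Nat.floor_le hxN
    have hi2 : x * N < i + 1 := Nat.lt_floor_add_one _
    have hy1 : (i : ℝ) / N ≤ x := by rwa [div_le_iff₀ hNpos]
    have hy2 : x - i / N ≤ 1 / N := by
      rw [sub_le_iff_le_add, ← add_div, le_div_iff₀ hNpos]; linarith
    have hiN : i ≤ N := by
      have : (i : ℝ) ≤ N := by nlinarith [hx.2]
      exact_mod_cast this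
    have := abs_sub_le_of_altDiff hk hec' hD' hM' hx
      (y := i / N) ⟨by positivity, hy1.trans hx.2⟩
    rw [abs_of_nonneg (sub_nonneg.2 hy1)] at this
    have hM0 : 0 ≤ M := abs_nonneg _
    have hstep : 2 ^ (k + 2) * k * M * (x - i / N) ≤ M / 2 := by
      calc 2 ^ (k + 2) * k * M * (x - i / N) ≤ 2 ^ (k + 2) * k * M * (1 / N) :=
            mul_le_mul_of_nonneg_left hy2 (by positivity)
        _ = M / 2 := by
            have : (N : ℝ) = 2 * (2 ^ (k + 2) * k) := by rw [hN, hn]; push_cast; ring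
            rw [this]
            have hk' : (0 : ℝ) < k := by exact_mod_cast hk
            field_simp
    have h3 := abs_sub_abs_le_abs_sub (e' x) (e' (i / N))
    linarith [hg' i hiN]
  have all : ∀ x ∈ Set.Icc (0 : ℝ) 1, |e x| ≤ (K + 2) * W + M / 2 := by
    intro x hx
    rcases le_total x (1 / 2) with h | h
    · exact half e hec heD hMb hgrid x ⟨hx.1, h⟩
    · have := half (fun s => e (1 - s)) (by fun_prop) ?_ ?_ ?_ (1 - x)
        ⟨by linarith [hx.2], by linarith⟩
      · simpa using this
      · intro y u hy hu
        have := heD (1 - y) (-u) ⟨by linarith [hy.2], by linarith [hy.1]⟩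
          ⟨by linarith [hu.2], by linarith [hu.1]⟩
        convert this using 2
        simp only [altDiff]
        refine Finset.sum_congr rfl fun i _ => ?_
        congr 2
        ring
      · intro s hs
        exact hMb _ ⟨by linarith [hs.2], by linarith [hs.1]⟩
      · intro i hi
        have : (1 : ℝ) - i / N = ((N - i : ℕ) : ℝ) / N := by
          rw [Nat.cast_sub hi]; field_simp
        rw [this]
        exact hgrid _ (by omega)
  intro x hx
  have h1 := all x₀ hx₀
  have h2 := hMb x hx
  change |e x| ≤ _
  linarith

/-- **Whitney's inequality** on a compact interval. -/
theorem exists_whitney {k : ℕ} (hk : 0 < k) : ∃ C : ℝ, 0 < C ∧ ∀ a b : ℝ, a < b →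
    ∀ g : ℝ → ℝ, ContinuousOn g (Set.Icc a b) → ∀ W : ℝ, 0 ≤ W →
    (∀ y u, y ∈ Set.Icc a b → y + k * u ∈ Set.Icc a b → |altDiff k g y u| ≤ W) →
    ∃ P : ℝ[X], P.degree < (k : WithBot ℕ) ∧ ∀ x ∈ Set.Icc a b, |g x - P.eval x| ≤ C * W := by
  obtain ⟨C₀, hC, hu⟩ := exists_whitney_unit hk
  refine ⟨C₀, hC, fun a b hab g hg W hW hD => ?_⟩
  have hk' : (0 : ℝ) < k := by exact_mod_cast hk
  have hl : 0 < b - a := sub_pos.2 hab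
  set G : ℝ → ℝ := Set.IccExtend hab.le ((Set.Icc a b).domRestrict g) with hG
  have hGc : Continuous G := (continuousOn_iff_continuous_domRestrict.1 hg).Icc_extend'
  have hGe : ∀ x ∈ Set.Icc a b, G x = g x := fun x hx => by
    rw [hG, Set.IccExtend_of_mem _ _ hx]; rfl
  have hmem : ∀ s ∈ Set.Icc (0 : ℝ) 1, a + s * (b - a) ∈ Set.Icc a b := fun s hs =>
    ⟨by nlinarith [hs.1], by nlinarith [hs.2]⟩
  have hD' : ∀ y u, y ∈ Set.Icc (0 : ℝ) 1 → y + k * u ∈ Set.Icc (0 : ℝ) 1 →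
      |altDiff k (fun s => G (a + s * (b - a))) y u| ≤ W := by
    intro y u hy hyu
    have := hD (a + y * (b - a)) (u * (b - a)) (hmem y hy)
      (by convert hmem _ hyu using 1; ring)
    convert this using 2
    simp only [altDiff]
    refine Finset.sum_congr rfl fun i hi => ?_
    have hi' : (i : ℝ) ≤ k := by exact_mod_cast Nat.lt_succ_iff.1 (Finset.mem_range.1 hi)
    have hconv : y + i * u ∈ Set.Icc (0 : ℝ) 1 := by
      have := (convex_Icc (0 : ℝ) 1) hy hyu (a := 1 - (i : ℝ) / k) (b := (i : ℝ) / k)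
        (sub_nonneg.2 ((div_le_one hk').2 hi')) (by positivity) (by ring)
      convert this using 1
      simp only [smul_eq_mul]
      field_simp
      ring
    rw [hGe _ (hmem _ hconv)]
    congr 2
    ring
  obtain ⟨P, hP, hb⟩ := hu (fun s => G (a + s * (b - a))) (by fun_prop) W hW hD'
  refine ⟨P.comp (C (-a / (b - a)) + C (1 / (b - a)) * X), ?_, fun x hx => ?_⟩
  · rcases eq_or_ne (P.comp (C (-a / (b - a)) + C (1 / (b - a)) * X)) 0 with h0 | h0
    · rw [h0, degree_zero]; exact WithBot.bot_lt_coe k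
    · have h1 : P.natDegree < k := by
        rcases eq_or_ne P 0 with rfl | h0
        · simpa using hk
        · exact (natDegree_lt_iff_degree_lt h0).2 hP
      rw [← natDegree_lt_iff_degree_lt h0]
      have h2 : (C (-a / (b - a)) + C (1 / (b - a)) * X : ℝ[X]).natDegree ≤ 1 := by
        compute_degree
      calc _ ≤ P.natDegree * _ := natDegree_comp_le
        _ ≤ P.natDegree * 1 := Nat.mul_le_mul_left _ h2
        _ < k := by omega
  · have := hb ((x - a) / (b - a)) ⟨div_nonneg (by linarith [hx.1]) hl.le,
      by rw [div_le_one hl]; linarith [hx.2]⟩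
    simp only [div_mul_cancel₀ _ hl.ne', add_sub_cancel, hGe x hx] at this
    simp only [eval_comp, eval_add, eval_mul, eval_C, eval_X]
    have hpt : -a / (b - a) + 1 / (b - a) * x = (x - a) / (b - a) := by ring
    rw [hpt]
    exact this

end Whitney

section HermiteBound

open Polynomial

/-- **Rolle's theorem** with multiplicities: `Φ l` is the `l`-th derivative of `Φ 0`. -/
theorem exists_eq_zero_of_multiplicity {a b : ℝ} (n : ℕ) : ∀ (Φ : ℕ → ℝ → ℝ) (x : ℕ → ℝ),
    (∀ l < n, ∀ y ∈ Set.Icc a b, HasDerivWithinAt (Φ l) (Φ (l + 1) y) (Set.Icc a b) y) →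
    (∀ j ≤ n, x j ∈ Set.Icc a b) → (∀ i j, i ≤ j → j ≤ n → x i ≤ x j) →
    (∀ j l, j + l ≤ n → x j = x (j + l) → Φ l (x j) = 0) → ∃ ξ ∈ Set.Icc a b, Φ n ξ = 0 := by
  induction n with
  | zero =>
    intro Φ x _ hx _ h0
    exact ⟨x 0, hx 0 le_rfl, h0 0 0 le_rfl rfl⟩
  | succ n ih =>
    intro Φ x hΦ hx hmono h0
    have hη : ∀ j : ℕ, ∃ η : ℝ, j ≤ n → η ∈ Set.Icc (x j) (x (j + 1)) ∧ Φ 1 η = 0 ∧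
        (x j < x (j + 1) → η ∈ Set.Ioo (x j) (x (j + 1))) := by
      intro j
      by_cases hj : j ≤ n
      · rcases (hmono j (j + 1) (by omega) (by omega)).eq_or_lt with h | h
        · exact ⟨x j, fun _ => ⟨⟨le_rfl, h.le⟩, h0 j 1 (by omega) h, fun h' => absurd h h'.ne⟩⟩
        · have ha := (hx j (by omega)).1
          have hb := (hx (j + 1) (by omega)).2
          obtain ⟨η, hη, hη0⟩ := exists_hasDerivAt_eq_zero (f := Φ 0) (f' := Φ 1) h
            (fun y hy => ((hΦ 0 (by omega) y ⟨ha.trans hy.1, hy.2.trans hb⟩).continuousWithinAt).mono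
              (Set.Icc_subset_Icc ha hb))
            (by rw [h0 j 0 (by omega) rfl, h0 (j + 1) 0 (by omega) rfl])
            (fun y hy => (hΦ 0 (by omega) y ⟨ha.trans hy.1.le, hy.2.le.trans hb⟩).hasDerivAt
              (Icc_mem_nhds (ha.trans_lt hy.1) (hy.2.trans_le hb)))
          exact ⟨η, fun _ => ⟨⟨hη.1.le, hη.2.le⟩, hη0, fun _ => hη⟩⟩
      · exact ⟨0, fun h => absurd h hj⟩
    choose η hη using hη
    refine ih (fun l => Φ (l + 1)) η (fun l hl => hΦ (l + 1) (by omega)) ?_ ?_ ?_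
    · intro j hj
      have := (hη j hj).1
      exact ⟨(hx j (by omega)).1.trans this.1, this.2.trans (hx (j + 1) (by omega)).2⟩
    · intro i j hij hj
      rcases hij.eq_or_lt with rfl | h
      · exact le_rfl
      · exact ((hη i (by omega)).1.2.trans (hmono (i + 1) j h (by omega))).trans (hη j hj).1.1
    · intro j l hjl heq
      rcases Nat.eq_zero_or_pos l with rfl | hl
      · exact (hη j (by omega)).2.1
      · obtain ⟨⟨h1, h2⟩, -, h3⟩ := hη j (by omega)
        obtain ⟨⟨h1', h2'⟩, -, h3'⟩ := hη (j + l) (by omega)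
        have h4 := hmono (j + 1) (j + l) (by omega) (by omega)
        have e1 : x j = x (j + 1) := by
          by_contra hne
          have := (h3 (lt_of_le_of_ne (hmono j (j + 1) (by omega) (by omega)) hne)).2
          linarith
        have e2 : x (j + l) = x (j + l + 1) := by
          by_contra hne
          have := (h3' (lt_of_le_of_ne (hmono (j + l) (j + l + 1) (by omega) (by omega)) hne)).1
          linarith
        have e3 : η j = x j := by linarith
        rw [e3]
        exact h0 j (l + 1) (by omega) (by rw [← add_assoc]; linarith)

theorem lt_count_map_range' {x : ℕ → ℝ} {i n a l : ℕ}
    (hmono : ∀ p q, p ≤ q → q ≤ i + n → x p ≤ x q) (hia : i ≤ a) (hal : a + l ≤ i + n)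
    (h : x a = x (a + l)) :
    l < (((List.range' i (n + 1)).map x : List ℝ) : Multiset ℝ).count (x a) := by
  have hrep : (List.range' a (l + 1)).map x = List.replicate (l + 1) (x a) := by
    refine List.eq_replicate_iff.2 ⟨by simp, fun z hz => ?_⟩
    obtain ⟨q, hq, rfl⟩ := List.mem_map.1 hz
    rw [List.mem_range'_1] at hq
    refine le_antisymm ?_ (hmono a q hq.1 (by omega))
    rw [h]
    exact hmono q (a + l) (by omega) hal
  obtain ⟨d, rfl⟩ := Nat.exists_eq_add_of_le hia
  have hsplit : List.range' i (n + 1) = List.range' i d ++ (List.range' (i + d) (l + 1) ++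
      List.range' (i + d + (l + 1)) (n + 1 - d - (l + 1))) := by
    rw [List.range'_append_1, List.range'_append_1]
    congr 1
    omega
  rw [hsplit, Multiset.coe_count, List.map_append, List.map_append, List.count_append,
    List.count_append, hrep, List.count_replicate_self]
  omega

theorem abs_coeff_le_of_isHermite {F : ℕ → ℝ → ℝ} {a b K : ℝ} {n i : ℕ} {x : ℕ → ℝ} {H : ℝ[X]}
    (hF : ∀ l < n, ∀ y ∈ Set.Icc a b, HasDerivWithinAt (F l) (F (l + 1) y) (Set.Icc a b) y)
    (hK : ∀ y ∈ Set.Icc a b, |F n y| ≤ K) (hx : ∀ j ≤ i + n, x j ∈ Set.Icc a b)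
    (hmono : ∀ p q, p ≤ q → q ≤ i + n → x p ≤ x q)
    (hH : IsHermite F ((List.range' i (n + 1)).map x : List ℝ) H) : |H.coeff n| ≤ K := by
  obtain ⟨ξ, hξ, h0⟩ := exists_eq_zero_of_multiplicity (a := a) (b := b) n
    (fun l y => F l y - (derivative^[l] H).eval y) (fun j => x (i + j))
    (fun l hl y hy => by
      have := (hF l hl y hy).sub ((derivative^[l] H).hasDerivAt y).hasDerivWithinAt
      rw [← Function.iterate_succ_apply' derivative l H] at this
      exact this)
    (fun j hj => hx _ (by omega)) (fun p q hpq hq => hmono _ _ (by omega) (by omega))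
    (fun j l hjl heq => by
      rw [hH.2 _ l (lt_count_map_range' hmono (by omega) (by omega)
        (by simpa [add_assoc] using heq)), sub_self])
  have hder : (derivative^[n] H).eval ξ = n.factorial * H.coeff n := by
    have : derivative^[n] H = C (n.factorial * H.coeff n) := by
      ext j
      rw [coeff_iterate_derivative, coeff_C]
      split_ifs with hj
      · simp [hj, Nat.descFactorial_self]
      · rw [(degree_lt_iff_coeff_zero _ _).1 hH.1 (j + n) (by simp; omega), smul_zero]
    rw [this, eval_C]
  have h1 : (n.factorial : ℝ) * H.coeff n = F n ξ := by rw [← hder]; linarith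
  have h2 := hK ξ hξ
  rw [← h1, abs_mul, Nat.abs_cast] at h2
  have h3 : (1 : ℝ) ≤ n.factorial := by exact_mod_cast Nat.one_le_iff_ne_zero.2 n.factorial_ne_zero
  nlinarith [abs_nonneg (H.coeff n)]

theorem exists_isHermite_range' (F : ℕ → ℝ → ℝ) (x : ℕ → ℝ) (i n : ℕ) :
    ∃ H : ℝ[X], IsHermite F ((List.range' i (n + 1)).map x : List ℝ) H ∧
      H.coeff n = divDiff F ((List.range' i (n + 1)).map x) :=
  exists_isHermite_divDiff F n _ (by simp)

/-- Divided differences of a function with controlled derivatives, at knots of which no `r + 2`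
consecutive ones cluster. -/
theorem abs_divDiff_mul_le {F : ℕ → ℝ → ℝ} {a b K lam : ℝ} {r m : ℕ} {x : ℕ → ℝ} (hab : a < b)
    (hlam0 : 0 < lam) (hlam1 : lam ≤ 1) (hK0 : 0 ≤ K)
    (hF : ∀ l < r, ∀ y ∈ Set.Icc a b, HasDerivWithinAt (F l) (F (l + 1) y) (Set.Icc a b) y)
    (hK : ∀ l ≤ r, ∀ y ∈ Set.Icc a b, |F l y| ≤ K * (b - a) ^ (r - l))
    (hx : ∀ j ≤ m, x j ∈ Set.Icc a b) (hmono : ∀ p q, p ≤ q → q ≤ m → x p ≤ x q)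
    (hsep : ∀ j, j + r + 1 ≤ m → lam * (b - a) ≤ x (j + r + 1) - x j) (n : ℕ) :
    ∀ i, i + n ≤ m → |divDiff F ((List.range' i (n + 1)).map x)| * (b - a) ^ n ≤
      (2 / lam) ^ n * (K * (b - a) ^ r) := by
  have hl : 0 < b - a := sub_pos.2 hab
  have h2 : 1 ≤ 2 / lam := by rw [le_div_iff₀ hlam0]; linarith
  induction n with
  | zero =>
    intro i hi
    obtain ⟨H, hH, hc⟩ := exists_isHermite_range' F x i 0
    rw [← hc]
    have := abs_coeff_le_of_isHermite (n := 0) (by simp) (fun y hy => hK 0 (by omega) y hy)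
      (fun j hj => hx j (by omega)) (fun p q hpq hq => hmono p q hpq (by omega)) hH
    simpa using this
  | succ n ih =>
    intro i hi
    obtain ⟨H, hH, hc⟩ := exists_isHermite_range' F x i (n + 1)
    rw [← hc]
    rcases le_or_gt (n + 1) r with hn | hn
    · have := abs_coeff_le_of_isHermite (n := n + 1) (fun l hl' => hF l (by omega))
        (fun y hy => hK (n + 1) hn y hy)
        (fun j hj => hx j (by omega)) (fun p q hpq hq => hmono p q hpq (by omega)) hH
      calc |H.coeff (n + 1)| * (b - a) ^ (n + 1)
          ≤ K * (b - a) ^ (r - (n + 1)) * (b - a) ^ (n + 1) :=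
            mul_le_mul_of_nonneg_right this (by positivity)
        _ = 1 * (K * (b - a) ^ r) := by
            rw [mul_assoc, ← pow_add, Nat.sub_add_cancel hn, one_mul]
        _ ≤ _ := mul_le_mul_of_nonneg_right (one_le_pow₀ h2) (by positivity)
    · have hgap : lam * (b - a) ≤ x (i + (n + 1)) - x i := by
        have h3 := hsep i (by omega)
        have h4 := hmono (i + r + 1) (i + (n + 1)) (by omega) hi
        linarith
      have hpos : 0 < lam * (b - a) := mul_pos hlam0 hl
      have hne : x (i + (n + 1)) ≠ x i := by intro h; rw [h] at hgap; linarith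
      obtain ⟨H₁, hH₁, hc₁⟩ := exists_isHermite_range' F x (i + 1) n
      obtain ⟨H₂, hH₂, hc₂⟩ := exists_isHermite_range' F x i n
      set T : Multiset ℝ := (((List.range' (i + 1) n).map x : List ℝ) : Multiset ℝ) with hT
      have hTcard : Multiset.card T = n := by simp [hT]
      have e₁ : (((List.range' (i + 1) (n + 1)).map x : List ℝ) : Multiset ℝ) =
          x (i + (n + 1)) ::ₘ T := by
        rw [hT, List.range'_1_concat, List.map_append, ← Multiset.coe_add, add_comm,
          show i + 1 + n = i + (n + 1) by omega]
        rfl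
      have e₂ : (((List.range' i (n + 1)).map x : List ℝ) : Multiset ℝ) = x i ::ₘ T := by
        rw [hT, List.range'_succ]; rfl
      have e₃ : (((List.range' i (n + 1 + 1)).map x : List ℝ) : Multiset ℝ) =
          x i ::ₘ x (i + (n + 1)) ::ₘ T := by
        rw [← e₁, List.range'_succ]; rfl
      rw [e₁] at hH₁
      rw [e₂] at hH₂
      rw [e₃] at hH
      have hA := hH.unique (hH₁.aitken hne hH₂)
      have hcoef := coeff_aitken hH₁ hH₂
      rw [← hA, hTcard, hc₁, hc₂] at hcoef
      have b₁ := ih (i + 1) (by omega)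
      have b₂ := ih i (by omega)
      set d₁ := divDiff F ((List.range' (i + 1) (n + 1)).map x)
      set d₂ := divDiff F ((List.range' i (n + 1)).map x)
      rw [hcoef, abs_div, abs_of_pos (hpos.trans_le hgap)]
      have h5 : |d₁ - d₂| ≤ |d₁| + |d₂| := abs_sub _ _
      have h6 : |d₁ - d₂| * (b - a) ^ n ≤ 2 * ((2 / lam) ^ n * (K * (b - a) ^ r)) := by
        have := mul_le_mul_of_nonneg_right h5 (by positivity : 0 ≤ (b - a) ^ n)
        linarith
      calc |d₁ - d₂| / (x (i + (n + 1)) - x i) * (b - a) ^ (n + 1)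
          ≤ |d₁ - d₂| / (lam * (b - a)) * (b - a) ^ (n + 1) := by
            gcongr
        _ = |d₁ - d₂| * (b - a) ^ n / lam := by
            rw [pow_succ]; field_simp
        _ ≤ 2 * ((2 / lam) ^ n * (K * (b - a) ^ r)) / lam := by gcongr
        _ = _ := by rw [pow_succ]; ring

theorem abs_newtonSum_le {F : ℕ → ℝ → ℝ} {a b K lam : ℝ} {r m : ℕ} {x : ℕ → ℝ} (hab : a < b)
    (hlam0 : 0 < lam) (hlam1 : lam ≤ 1) (hK0 : 0 ≤ K)
    (hF : ∀ l < r, ∀ y ∈ Set.Icc a b, HasDerivWithinAt (F l) (F (l + 1) y) (Set.Icc a b) y)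
    (hK : ∀ l ≤ r, ∀ y ∈ Set.Icc a b, |F l y| ≤ K * (b - a) ^ (r - l))
    (hx : ∀ j ≤ m, x j ∈ Set.Icc a b) (hmono : ∀ p q, p ≤ q → q ≤ m → x p ≤ x q)
    (hsep : ∀ j, j + r + 1 ≤ m → lam * (b - a) ≤ x (j + r + 1) - x j) {t : ℝ}
    (ht : t ∈ Set.Icc a b) :
    |newtonSum F ((List.range' 0 (m + 1)).map x) t| ≤
      (∑ j ∈ Finset.range (m + 1), (2 / lam) ^ j) * (K * (b - a) ^ r) := by
  rw [newtonSum, Finset.sum_mul]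
  refine (Finset.abs_sum_le_sum_abs _ _).trans ?_
  simp only [List.length_map, List.length_range']
  refine Finset.sum_le_sum fun j hj => ?_
  have hj' : j ≤ m := Nat.lt_succ_iff.1 (Finset.mem_range.1 hj)
  have htake : ((List.range' 0 (m + 1)).map x).take (j + 1) = (List.range' 0 (j + 1)).map x := by
    rw [← List.map_take, List.take_range'_of_length_ge (by omega)]
  rw [abs_mul, htake]
  refine le_trans (mul_le_mul_of_nonneg_left ?_ (abs_nonneg _))
    (abs_divDiff_mul_le hab hlam0 hlam1 hK0 hF hK hx hmono hsep j 0 (by omega))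
  rw [Finset.abs_prod]
  refine (Finset.prod_le_prod (fun _ _ => abs_nonneg _) (g := fun _ => b - a)
    fun i hi => ?_).trans (by simp)
  have hi' : i < j := Finset.mem_range.1 hi
  have : ((List.range' 0 (m + 1)).map x).getD i 0 = x i := by
    rw [List.getD_eq_getElem _ _ (by simp; omega)]
    simp
  rw [this]
  have h1 := hx i (by omega)
  exact abs_le.2 ⟨by linarith [h1.2, ht.1], by linarith [h1.1, ht.2]⟩

theorem exists_antiderivative {k : ℕ} {P : ℝ[X]} (hP : P.degree < (k : WithBot ℕ)) (a c : ℝ) :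
    ∃ Q : ℝ[X], Q.degree < ((k + 1 : ℕ) : WithBot ℕ) ∧ derivative Q = P ∧ Q.eval a = c := by
  set Q : ℝ[X] := ∑ i ∈ Finset.range k, monomial (i + 1) (P.coeff i / (i + 1)) with hQ
  have hc : ∀ n, Q.coeff (n + 1) = if n < k then P.coeff n / (n + 1) else 0 := by
    intro n
    simp [hQ, finsetSum_coeff, coeff_monomial]
  refine ⟨Q + C (c - Q.eval a), ?_, ?_, by simp⟩
  · refine (degree_lt_iff_coeff_zero _ _).2 fun n hn => ?_
    obtain ⟨n, rfl⟩ : ∃ l, n = l + 1 := ⟨n - 1, by omega⟩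
    rw [coeff_add, hc, if_neg (by omega), coeff_C, if_neg (by omega), add_zero]
  · ext n
    rw [derivative_add, derivative_C, add_zero, coeff_derivative, hc]
    split_ifs with h
    · have : (n : ℝ) + 1 ≠ 0 := by positivity
      field_simp
    · rw [(degree_lt_iff_coeff_zero _ _).1 hP n (by omega), zero_mul]

/-- A polynomial approximating the top derivative integrates to one approximating all of them. -/
theorem exists_polynomial_approx_derivs {a b K : ℝ} (hab : a < b) (hK : 0 ≤ K) {k : ℕ} (r : ℕ) :
    ∀ (F : ℕ → ℝ → ℝ) (P : ℝ[X]), P.degree < (k : WithBot ℕ) →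
    (∀ l < r, ∀ y ∈ Set.Icc a b, HasDerivWithinAt (F l) (F (l + 1) y) (Set.Icc a b) y) →
    (∀ y ∈ Set.Icc a b, |F r y - P.eval y| ≤ K) →
    ∃ Q : ℝ[X], Q.degree < ((k + r : ℕ) : WithBot ℕ) ∧
      ∀ l ≤ r, ∀ y ∈ Set.Icc a b,
        |F l y - (derivative^[l] Q).eval y| ≤ K * (b - a) ^ (r - l) := by
  induction r with
  | zero =>
    intro F P hP _ h
    refine ⟨P, hP, fun l hl y hy => ?_⟩
    obtain rfl : l = 0 := by omega
    simpa using h y hy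
  | succ r ih =>
    intro F P hP hF h
    obtain ⟨Q₁, hQ₁, hb⟩ := ih (fun l => F (l + 1)) P hP (fun l hl => hF (l + 1) (by omega)) h
    obtain ⟨Q, hQ, hder, hev⟩ := exists_antiderivative hQ₁ a (F 0 a)
    refine ⟨Q, hQ, fun l hl y hy => ?_⟩
    rcases l with _ | l
    · have := (convex_Icc a b).norm_image_sub_le_of_norm_hasDerivWithin_le
        (f := fun y => F 0 y - Q.eval y) (f' := fun y => F 1 y - Q₁.eval y)
        (C := K * (b - a) ^ r)
        (fun z hz => by
          rw [← hder]
          exact (hF 0 (by omega) z hz).sub (Q.hasDerivAt z).hasDerivWithinAt)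
        (fun z hz => by simpa using hb 0 (by omega) z hz)
        (Set.left_mem_Icc.2 hab.le) hy
      rw [hev, sub_self, sub_zero, Real.norm_eq_abs, Real.norm_eq_abs,
        abs_of_nonneg (sub_nonneg.2 hy.1)] at this
      refine this.trans ?_
      rw [Nat.sub_zero, pow_succ, ← mul_assoc]
      exact mul_le_mul_of_nonneg_left (by linarith [hy.2])
        (mul_nonneg hK (pow_nonneg (sub_pos.2 hab).le _))
    · rw [Function.iterate_succ_apply, hder, Nat.succ_sub_succ]
      exact hb l (by omega) y hy

theorem IsHermite.add_polynomial {F : ℕ → ℝ → ℝ} {S : Multiset ℝ} {H Q : ℝ[X]}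
    (hH : IsHermite (fun l y => F l y - (derivative^[l] Q).eval y) S H)
    (hQ : Q.degree < (Multiset.card S : WithBot ℕ)) : IsHermite F S (H + Q) := by
  refine ⟨(degree_add_le _ _).trans_lt (max_lt hH.1 hQ), fun y l hl => ?_⟩
  rw [iterate_map_add, eval_add, hH.2 y l hl, sub_add_cancel]

end HermiteBound

section Modulus

theorem smoothOmega_nonneg (k : ℕ) (g : ℝ → ℝ) (t a b : ℝ) : 0 ≤ smoothOmega k g t a b :=
  Real.sSup_nonneg (by rintro v ⟨u, x, -, -, rfl⟩; exact abs_nonneg _)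

theorem bddAbove_kSymmDiff (k : ℕ) {g : ℝ → ℝ} {a b : ℝ} (hg : ContinuousOn g (Set.Icc a b))
    (t : ℝ) : BddAbove {v : ℝ | ∃ u x : ℝ, 0 < u ∧ u ≤ t ∧ v = |kSymmDiff k g u x a b|} := by
  obtain ⟨M, hM⟩ := isCompact_Icc.exists_bound_of_continuousOn hg
  refine ⟨∑ i ∈ Finset.range (k + 1), (k.choose i : ℝ) * |M|, ?_⟩
  rintro v ⟨u, x, hu, -, rfl⟩
  rw [kSymmDiff]
  split_ifs with h
  · refine (Finset.abs_sum_le_sum_abs _ _).trans (Finset.sum_le_sum fun i hi => ?_)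
    have hi' : (i : ℝ) ≤ k := by exact_mod_cast Nat.lt_succ_iff.1 (Finset.mem_range.1 hi)
    have hi0 : (0 : ℝ) ≤ i := Nat.cast_nonneg i
    rw [abs_mul, abs_mul, abs_pow, abs_neg, abs_one, one_pow, one_mul, Nat.abs_cast]
    refine mul_le_mul_of_nonneg_left ((hM _ ⟨?_, ?_⟩).trans (le_abs_self M)) (Nat.cast_nonneg _)
    · nlinarith [h.1]
    · nlinarith [h.2]
  · rw [abs_zero]; positivity

theorem abs_altDiff_le_smoothOmega {k : ℕ} (hk : 0 < k) {g : ℝ → ℝ} {a b : ℝ}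
    (hg : ContinuousOn g (Set.Icc a b)) {y u : ℝ} (hy : y ∈ Set.Icc a b)
    (hyu : y + k * u ∈ Set.Icc a b) : |altDiff k g y u| ≤ smoothOmega k g (b - a) a b := by
  have hk1 : (1 : ℝ) ≤ k := by exact_mod_cast hk
  rcases lt_trichotomy u 0 with hu | rfl | hu
  · refine le_csSup (bddAbove_kSymmDiff k hg _) ⟨-u, y + k / 2 * u, by linarith, ?_, ?_⟩
    · nlinarith [hy.2, hyu.1]
    · rw [kSymmDiff, if_pos ⟨by linarith [hyu.1], by linarith [hy.2]⟩, altDiff]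
      congr 1
      refine Finset.sum_congr rfl fun i _ => ?_
      congr 2
      ring
  · have : altDiff k g y 0 = 0 := by
      have h := Int.alternating_sum_range_choose_of_ne hk.ne'
      have h' : ∑ i ∈ Finset.range (k + 1), (-1 : ℝ) ^ i * (k.choose i) = 0 := by exact_mod_cast h
      simp only [altDiff, mul_zero, add_zero]
      rw [← Finset.sum_mul, h', zero_mul]
    rw [this, abs_zero]
    exact smoothOmega_nonneg _ _ _ _ _
  · refine le_csSup (bddAbove_kSymmDiff k hg _) ⟨u, y + k / 2 * u, hu, ?_, ?_⟩
    · nlinarith [hy.1, hyu.2]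
    · rw [kSymmDiff, if_pos ⟨by linarith [hy.1], by linarith [hyu.2]⟩, altDiff,
        ← Finset.sum_range_reflect]
      have hsum : ∀ i ∈ Finset.range (k + 1),
          (-1 : ℝ) ^ (k + 1 - 1 - i) * (k.choose (k + 1 - 1 - i)) *
            g (y + ((k + 1 - 1 - i : ℕ) : ℝ) * u) =
          (-1) ^ k * ((-1 : ℝ) ^ i * (k.choose i) *
            g (y + k / 2 * u + ((k : ℝ) / 2 - i) * u)) := by
        intro i hi
        have hi' : i ≤ k := Nat.lt_succ_iff.1 (Finset.mem_range.1 hi)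
        have hsign : (-1 : ℝ) ^ (k - i) = (-1) ^ k * (-1) ^ i := by
          rw [← pow_add, show k + i = 2 * i + (k - i) by omega, pow_add, pow_mul]; simp
        rw [Nat.add_sub_cancel, Nat.choose_symm hi', Nat.cast_sub hi', hsign,
          show y + ((k : ℝ) - i) * u = y + k / 2 * u + ((k : ℝ) / 2 - i) * u by ring]
        ring
      rw [Finset.sum_congr rfl hsum, ← Finset.mul_sum, abs_mul, abs_pow, abs_neg, abs_one,
        one_pow, one_mul]

end Modulus

/-- strengthened Whitney inequality for Hermite interpolation. -/
theorem stmt15 (r m : ℕ) (hm : r + 2 ≤ m) (lam : ℝ) (hlam0 : 0 < lam) (hlam1 : lam ≤ 1) :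
    ∃ C : ℝ, 0 < C ∧ ∀ x : ℕ → ℝ,
      (∀ i j : ℕ, i ≤ j → j ≤ m - 1 → x i ≤ x j) →
      (∀ j : ℕ, j + r + 1 ≤ m - 1 → lam * (x (m - 1) - x 0) ≤ x (j + r + 1) - x j) →
      x 0 < x (m - 1) →
      ∀ f : ℝ → ℝ, ContDiffOn ℝ r f (Set.Icc (x 0) (x (m - 1))) →
      ∀ t ∈ Set.Icc (x 0) (x (m - 1)),
        |f t - newtonSum (fun j => iteratedDerivWithin j f (Set.Icc (x 0) (x (m - 1))))
            (List.ofFn fun i : Fin m => x i) t| ≤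
          C * (x (m - 1) - x 0) ^ r *
            smoothOmega (m - r) (iteratedDerivWithin r f (Set.Icc (x 0) (x (m - 1))))
              (x (m - 1) - x 0) (x 0) (x (m - 1)) := by
  obtain ⟨C₀, hC₀, hW⟩ := exists_whitney (k := m - r) (by omega)
  obtain ⟨m, rfl⟩ : ∃ n, m = n + 1 := ⟨m - 1, by omega⟩
  set S : ℝ := ∑ j ∈ Finset.range (m + 1), (2 / lam) ^ j with hS
  have hS0 : 0 ≤ S := by positivity
  refine ⟨(1 + S) * C₀, by positivity, fun x hmono hsep hab f hf t ht => ?_⟩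
  simp only [Nat.add_sub_cancel] at hmono hsep hab hf ht ⊢
  have hud := uniqueDiffOn_Icc hab
  set F : ℕ → ℝ → ℝ := fun j => iteratedDerivWithin j f (Set.Icc (x 0) (x m)) with hFdef
  set W := smoothOmega (m + 1 - r) (F r) (x m - x 0) (x 0) (x m) with hWdef
  have hW0 : 0 ≤ W := smoothOmega_nonneg _ _ _ _ _
  have hF : ∀ l < r, ∀ y ∈ Set.Icc (x 0) (x m),
      HasDerivWithinAt (F l) (F (l + 1) y) (Set.Icc (x 0) (x m)) y := by
    intro l hl y hy
    have := (hf.differentiableOn_iteratedDerivWithin (m := l) (by exact_mod_cast hl) hud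
      y hy).hasDerivWithinAt
    rwa [← iteratedDerivWithin_succ] at this
  have hFr : ContinuousOn (F r) (Set.Icc (x 0) (x m)) :=
    hf.continuousOn_iteratedDerivWithin le_rfl hud
  obtain ⟨P, hP, hPb⟩ := hW (x 0) (x m) hab (F r) hFr W hW0
    fun y u hy hyu => abs_altDiff_le_smoothOmega (by omega) hFr hy hyu
  have hK0 : 0 ≤ C₀ * W := mul_nonneg hC₀.le hW0
  obtain ⟨Q, hQ, hQb⟩ := exists_polynomial_approx_derivs hab hK0 r F P hP hF hPb
  rw [Nat.sub_add_cancel (by omega : r ≤ m + 1)] at hQ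
  have hlist : (List.ofFn fun i : Fin (m + 1) => x i) = (List.range' 0 (m + 1)).map x :=
    List.ext_getElem (by simp) fun i h₁ h₂ => by
      simp only [List.getElem_ofFn, List.getElem_map, List.getElem_range', zero_add, one_mul]
  rw [hlist]
  obtain ⟨H, hH, -⟩ := exists_isHermite_range'
    (fun l y => F l y - (Polynomial.derivative^[l] Q).eval y) x 0 m
  have hHF : IsHermite F _ (H + Q) := hH.add_polynomial (by simpa using hQ)
  have hbd := abs_newtonSum_le hab hlam0 hlam1 hK0 (r := r)
    (F := fun l y => F l y - (Polynomial.derivative^[l] Q).eval y)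
    (fun l hl y hy => by
      have := (hF l hl y hy).sub
        ((Polynomial.derivative^[l] Q).hasDerivAt y).hasDerivWithinAt
      rw [← Function.iterate_succ_apply' Polynomial.derivative l Q] at this
      exact this)
    hQb (fun j hj => ⟨hmono 0 j (Nat.zero_le _) hj, hmono j m hj le_rfl⟩) hmono hsep ht
  rw [newtonSum_eq_eval hH] at hbd
  rw [newtonSum_eq_eval hHF, Polynomial.eval_add]
  have h0 := hQb 0 (Nat.zero_le _) t ht
  have hf0 : F 0 t = f t := by rw [hFdef]; simp
  simp only [hf0, Function.iterate_zero, id, Nat.sub_zero] at h0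
  calc |f t - (H.eval t + Q.eval t)| = |(f t - Q.eval t) - H.eval t| := by congr 1; ring
    _ ≤ |f t - Q.eval t| + |H.eval t| := abs_sub _ _
    _ ≤ C₀ * W * (x m - x 0) ^ r + S * (C₀ * W * (x m - x 0) ^ r) := add_le_add h0 hbd
    _ = _ := by ring
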